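/- Characterization of stationary solutions (Proposition 1.2 (i)). Let w : (−1,1) → ℝ^m be a C² function with ∫_{−1}^{1}(|w'(y)|²(1−y²)+|w(y)|²)ρ(y) dy < ∞ which satisfies, for all y ∈ (−1,1), the stationary equation ρ(y)^{−1} (ρ(y)(1−y²) w'(y))' − 2(p+1)/(p−1)² · w(y) + |w(y)|^{p−1} w(y) = 0. Then either w ≡ 0, or there exist d ∈ (−1,1) and a unit vector Ω ∈ ℝ^m (|Ω| = 1) such that w(y) = κ(d,y) Ω for all y ∈ (−1,1). -/

import Mathlib

open MeasureTheory Real Set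

/-- `κ₀ = (2(p+1)/(p-1)²)^{1/(p-1)}` -/
noncomputable def kappa0 (p : ℝ) : ℝ := (2 * (p + 1) / (p - 1) ^ 2) ^ (1 / (p - 1))

/-- `κ(d,y) = κ₀ (1-d²)^{1/(p-1)} (1+dy)^{-2/(p-1)}` -/
noncomputable def kappa (p d y : ℝ) : ℝ :=
  kappa0 p * (1 - d ^ 2) ^ (1 / (p - 1)) * (1 + d * y) ^ (-(2 / (p - 1)))

/-- the weight `ρ(y) = (1-y²)^{2/(p-1)}` -/
noncomputable def rho (p y : ℝ) : ℝ := (1 - y ^ 2) ^ (2 / (p - 1))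

lemma sc_hasDerivAt_tanh (x : ℝ) : HasDerivAt Real.tanh ((Real.cosh x ^ 2)⁻¹) x := by
  have h := (Real.hasDerivAt_sinh x).div (Real.hasDerivAt_cosh x) (Real.cosh_pos x).ne'
  have e : Real.tanh = Real.sinh / Real.cosh := by
    funext y; simp [Real.tanh_eq_sinh_div_cosh]
  rw [e]
  have h1 := Real.cosh_sq x
  have h2 : Real.cosh x * Real.cosh x - Real.sinh x * Real.sinh x = 1 := by nlinarith
  rw [h2, one_div] at h
  exact h

lemma sc_continuous_tanh : Continuous Real.tanh :=
  continuous_iff_continuousAt.2 fun x => (sc_hasDerivAt_tanh x).continuousAt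

lemma sc_tanh_mono : Monotone Real.tanh := by
  apply monotone_of_deriv_nonneg
  · exact fun x => (sc_hasDerivAt_tanh x).differentiableAt
  · intro x; rw [(sc_hasDerivAt_tanh x).deriv]; positivity

lemma sc_tanh_one_pos : 0 < Real.tanh 1 := by
  rw [Real.tanh_eq_sinh_div_cosh]
  exact div_pos (Real.sinh_pos_iff.2 one_pos) (Real.cosh_pos 1)

lemma sc_const_zero {c T : ℝ} {f : ℝ → ℝ} (hf : IntegrableOn f (Ioi T))
    (h : ∀ x ∈ Ioi T, |c| ≤ f x) : c = 0 := by
  have : IntegrableOn (fun _ : ℝ => c) (Ioi T) := by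
    refine Integrable.mono' hf aestronglyMeasurable_const ?_
    filter_upwards [ae_restrict_mem measurableSet_Ioi] with x hx
    simpa using h x hx
  rw [integrableOn_const_iff] at this
  simpa using this

section
variable {E : Type*} [NormedAddCommGroup E] [InnerProductSpace ℝ E]

lemma sc_young (W g : E) (s : ℝ) (hs : 0 < s) :
    2 * inner ℝ W g ≤ s * ‖W‖ ^ 2 + ‖g‖ ^ 2 / s := by
  have h1 := real_inner_le_norm W g
  have h2 : 0 ≤ (s * ‖W‖ - ‖g‖) ^ 2 / s := by positivity
  have h3 : (s * ‖W‖ - ‖g‖) ^ 2 / s = s * ‖W‖ ^ 2 + ‖g‖ ^ 2 / s - 2 * (‖W‖ * ‖g‖) := by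
    field_simp; ring
  linarith

lemma sc_decay (a : ℝ) (ha : 0 < a) (W V : ℝ → E) (hW : ∀ x, HasDerivAt W (V x) x)
    (hV : Continuous V)
    (hint : Integrable (fun x => ‖V x + (a * Real.tanh x) • W x‖ ^ 2)) :
    IntegrableOn (fun x => ‖W x‖ ^ 2) (Ioi 1) ∧
    Filter.Tendsto (fun x => ‖W x‖ ^ 2) Filter.atTop (nhds 0) := by
  have hWc : Continuous W := continuous_iff_continuousAt.2 fun x => (hW x).continuousAt
  set h : ℝ → ℝ := fun x => ‖V x + (a * Real.tanh x) • W x‖ ^ 2 with hh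
  have hq : ∀ x, HasDerivAt (fun x => ‖W x‖ ^ 2) (2 * inner ℝ (W x) (V x)) x :=
    fun x => (hW x).norm_sq
  have hq'c : Continuous (fun x => 2 * inner ℝ (W x) (V x)) := by fun_prop
  have hqc : Continuous (fun x => ‖W x‖ ^ 2) := by fun_prop
  have hid : ∀ x, inner ℝ (W x) (V x) =
      inner ℝ (W x) (V x + (a * Real.tanh x) • W x) - a * Real.tanh x * ‖W x‖ ^ 2 := by
    intro x
    rw [inner_add_right, real_inner_smul_right, real_inner_self_eq_norm_sq]; ring
  set s := a * Real.tanh 1 with hs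
  have hs0 : 0 < s := mul_pos ha sc_tanh_one_pos
  have hle : ∀ x, 1 ≤ x → 2 * inner ℝ (W x) (V x) ≤ h x / s - s * ‖W x‖ ^ 2 := by
    intro x hx
    have h1 := sc_young (W x) (V x + (a * Real.tanh x) • W x) s hs0
    have h2 : s ≤ a * Real.tanh x := mul_le_mul_of_nonneg_left (sc_tanh_mono hx) ha.le
    have h3 : s * ‖W x‖ ^ 2 ≤ a * Real.tanh x * ‖W x‖ ^ 2 :=
      mul_le_mul_of_nonneg_right h2 (by positivity)
    rw [hid x]
    simp only [hh]
    linarith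
  have hqi : IntegrableOn (fun x => ‖W x‖ ^ 2) (Ioi 1) := by
    refine integrableOn_Ioi_of_intervalIntegral_norm_bounded
      ((‖W 1‖ ^ 2 + (∫ x, h x) / s) / s) 1 (b := fun T : ℝ => T) (l := Filter.atTop) ?_
      Filter.tendsto_id ?_
    · intro T
      exact (hqc.integrableOn_Icc).mono_set Ioc_subset_Icc_self
    · filter_upwards [Filter.eventually_ge_atTop 1] with T hT
      have e1 := intervalIntegral.integral_eq_sub_of_hasDerivAt (a := 1) (b := T)
        (fun x _ => hq x) (hq'c.intervalIntegrable _ _)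
      have hhi : IntervalIntegrable h volume 1 T := hint.intervalIntegrable
      have e2 : ∫ x in (1:ℝ)..T, 2 * inner ℝ (W x) (V x) ≤
          ∫ x in (1:ℝ)..T, (h x / s - s * ‖W x‖ ^ 2) := by
        apply intervalIntegral.integral_mono_on hT (hq'c.intervalIntegrable _ _)
        · exact (hhi.div_const s).sub ((hqc.const_mul s |>.intervalIntegrable _ _))
        · intro x hx; exact hle x hx.1
      rw [e1, intervalIntegral.integral_sub (hhi.div_const s)
        ((hqc.const_mul s).intervalIntegrable _ _),
        intervalIntegral.integral_div, intervalIntegral.integral_const_mul] at e2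
      have e3 : ∫ x in (1:ℝ)..T, h x ≤ ∫ x, h x := by
        rw [intervalIntegral.integral_of_le hT]
        exact setIntegral_le_integral hint (Filter.Eventually.of_forall fun x => by
          simp only [hh]; positivity)
      have e4 : (∫ x in (1:ℝ)..T, h x) / s ≤ (∫ x, h x) / s := by gcongr
      have e5 : 0 ≤ ‖W T‖ ^ 2 := by positivity
      simp only [norm_pow, norm_norm]
      rw [le_div_iff₀ hs0]
      linarith
  refine ⟨hqi, ?_⟩
  refine tendsto_zero_of_hasDerivAt_of_integrableOn_Ioi (a := 1) (fun x _ => hq x) ?_ hqi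
  have hb : IntegrableOn (fun x => h x + (1 + 2 * a) * ‖W x‖ ^ 2) (Ioi 1) :=
    hint.integrableOn.add (hqi.const_mul _)
  refine Integrable.mono' hb hq'c.aestronglyMeasurable ?_
  refine Filter.Eventually.of_forall fun x => ?_
  rw [hid x, Real.norm_eq_abs]
  have h1 := sc_young (W x) (V x + (a * Real.tanh x) • W x) 1 one_pos
  have h2 := sc_young (W x) (-(V x + (a * Real.tanh x) • W x)) 1 one_pos
  rw [inner_neg_right, norm_neg] at h2
  have t1 := Real.tanh_lt_one x
  have t2 := Real.neg_one_lt_tanh x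
  have h5 : 0 ≤ a * ‖W x‖ ^ 2 := by positivity
  simp only [hh]
  rw [abs_le]
  constructor <;> nlinarith
end

section
variable {E : Type*} [NormedAddCommGroup E] [InnerProductSpace ℝ E]

lemma sc_eq_of_hasDerivAt_zero {F : Type*} [NormedAddCommGroup F] [NormedSpace ℝ F] {f f' : ℝ → F}
    (h : ∀ x, HasDerivAt f (f' x) x)
    (h0 : ∀ x, f' x = 0) (x y : ℝ) : f x = f y :=
  is_const_of_deriv_eq_zero (𝕜 := ℝ) (fun x => (h x).differentiableAt)
    (fun x => by rw [(h x).deriv, h0]) x y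

lemma sc_conserved (b : ℝ) (hb : 0 < b) (W V : ℝ → E) (hW : ∀ x, HasDerivAt W (V x) x)
    (hV : ∀ x, HasDerivAt V ((1 / b) ^ 2 • W x - ((‖W x‖ ^ 2) ^ b) • W x) x)
    (hint : Integrable (fun x => ‖V x + (1 / b * Real.tanh x) • W x‖ ^ 2)) :
    (∀ x, ‖V x‖ ^ 2 = (1 / b) ^ 2 * ‖W x‖ ^ 2 - (‖W x‖ ^ 2) ^ (b + 1) / (b + 1)) ∧
    (∀ x f, ‖W x‖ ^ 2 * inner ℝ (V x) f = inner ℝ (W x) f * inner ℝ (W x) (V x)) := by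
  have ha : 0 < 1 / b := by positivity
  set a := 1 / b with hadef
  have hVc : Continuous V := continuous_iff_continuousAt.2 fun x => (hV x).continuousAt
  obtain ⟨hqi, hq0⟩ := sc_decay a ha W V hW hVc hint
  have hq : ∀ x, HasDerivAt (fun x => ‖W x‖ ^ 2) (2 * inner ℝ (W x) (V x)) x :=
    fun x => (hW x).norm_sq
  obtain ⟨T, hT1, hT⟩ : ∃ T : ℝ, 1 ≤ T ∧ ∀ x, T ≤ x → ‖W x‖ ^ 2 ≤ 1 := by
    have h1 : ∀ᶠ x in Filter.atTop, ‖W x‖ ^ 2 ≤ 1 :=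
      hq0.eventually (eventually_le_nhds one_pos)
    obtain ⟨T, hT⟩ := Filter.eventually_atTop.1 (h1.and (Filter.eventually_ge_atTop 1))
    exact ⟨T, (hT T le_rfl).2, fun x hx => (hT x hx).1⟩
  have hVle : ∀ x, ‖V x‖ ^ 2 ≤ 2 * ‖V x + (a * Real.tanh x) • W x‖ ^ 2 + 2 * a ^ 2 * ‖W x‖ ^ 2 := by
    intro x
    have e : V x = (V x + (a * Real.tanh x) • W x) - (a * Real.tanh x) • W x := by simp
    have h1 := norm_sub_le (V x + (a * Real.tanh x) • W x) ((a * Real.tanh x) • W x)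
    rw [← e, norm_smul, Real.norm_eq_abs, abs_mul, abs_of_pos ha] at h1
    have t : |Real.tanh x| ≤ 1 := (abs_lt.2 ⟨Real.neg_one_lt_tanh x, Real.tanh_lt_one x⟩).le
    have h2 : a * |Real.tanh x| * ‖W x‖ ≤ a * ‖W x‖ := by
      apply mul_le_mul_of_nonneg_right _ (norm_nonneg _)
      nlinarith
    have h3 : ‖V x‖ ≤ ‖V x + (a * Real.tanh x) • W x‖ + a * ‖W x‖ := by linarith
    have h4 : ‖V x‖ ^ 2 ≤ (‖V x + (a * Real.tanh x) • W x‖ + a * ‖W x‖) ^ 2 := by gcongr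
    nlinarith [sq_nonneg (‖V x + (a * Real.tanh x) • W x‖ - a * ‖W x‖)]
  have hdom : ∀ C D : ℝ, IntegrableOn (fun x => C * ‖V x + (a * Real.tanh x) • W x‖ ^ 2 +
      D * ‖W x‖ ^ 2) (Ioi T) := fun C D =>
    (hint.integrableOn.const_mul C).add
      ((hqi.mono_set (Ioi_subset_Ioi hT1)).const_mul D)
  constructor
  · have hE : ∀ x, HasDerivAt (fun x => ‖V x‖ ^ 2 - a ^ 2 * ‖W x‖ ^ 2 +
        (‖W x‖ ^ 2) ^ (b + 1) / (b + 1))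
        (2 * inner ℝ (V x) (a ^ 2 • W x - ((‖W x‖ ^ 2) ^ b) • W x)
          - a ^ 2 * (2 * inner ℝ (W x) (V x)) +
          (2 * inner ℝ (W x) (V x)) * (b + 1) * (‖W x‖ ^ 2) ^ (b + 1 - 1) / (b + 1)) x := by
      intro x
      exact (((hV x).norm_sq.sub ((hq x).const_mul _)).add
        (((hq x).rpow_const (p := b + 1) (Or.inr (by linarith))).div_const (b + 1)))
    have hc := sc_eq_of_hasDerivAt_zero hE (by
      intro x
      rw [inner_sub_right, real_inner_smul_right, real_inner_smul_right, real_inner_comm,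
        add_sub_cancel_right]
      field_simp
      ring)
    intro x
    have hz := sc_const_zero (c := ‖V x‖ ^ 2 - a ^ 2 * ‖W x‖ ^ 2 +
        (‖W x‖ ^ 2) ^ (b + 1) / (b + 1)) (hdom 2 (3 * a ^ 2 + 1)) (by
      intro y hy
      have e := hc x y
      rw [e]
      have h1 : (‖W y‖ ^ 2) ^ (b + 1) ≤ ‖W y‖ ^ 2 := by
        have := Real.rpow_le_rpow_of_exponent_ge' (x := ‖W y‖ ^ 2) (y := b + 1) (z := 1)
          (by positivity) (hT y (le_of_lt hy)) zero_le_one (by linarith)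
        simpa using this
      have h2 : (‖W y‖ ^ 2) ^ (b + 1) / (b + 1) ≤ ‖W y‖ ^ 2 :=
        (div_le_self (by positivity) (by linarith)).trans h1
      have h3 : 0 ≤ (‖W y‖ ^ 2) ^ (b + 1) / (b + 1) := by positivity
      have h4 := hVle y
      have h5 : 0 ≤ a ^ 2 * ‖W y‖ ^ 2 := by positivity
      have h6 : 0 ≤ ‖W y‖ ^ 2 := by positivity
      have h7 : 0 ≤ ‖V y‖ ^ 2 := by positivity
      have h8 : 0 ≤ ‖V y + (a * Real.tanh y) • W y‖ ^ 2 := by positivity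
      rw [abs_le]
      constructor <;> nlinarith)
    linarith
  · have key : ∀ e f : E, ∀ x, inner ℝ (W x) e * inner ℝ (V x) f -
        inner ℝ (W x) f * inner ℝ (V x) e = 0 := by
      intro e f
      have hd : ∀ (U : ℝ → E) (U' : E) (x : ℝ) (e : E), HasDerivAt U U' x →
          HasDerivAt (fun x => inner ℝ (U x) e) (inner ℝ U' e) x := by
        intro U U' x e hU
        simpa using hU.inner ℝ (hasDerivAt_const x e)
      have hL : ∀ x, HasDerivAt (fun x => inner ℝ (W x) e * inner ℝ (V x) f -
        inner ℝ (W x) f * inner ℝ (V x) e) _ x := fun x =>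
        ((hd W _ x e (hW x)).mul (hd V _ x f (hV x))).sub
          ((hd W _ x f (hW x)).mul (hd V _ x e (hV x)))
      have hc := sc_eq_of_hasDerivAt_zero hL (by
        intro x
        simp only [inner_sub_left, real_inner_smul_left]
        ring)
      intro x
      refine sc_const_zero (hdom (2 * (‖e‖ * ‖f‖)) ((2 * a ^ 2 + 1) * (‖e‖ * ‖f‖))) ?_
      intro y hy
      have e0 := hc x y
      rw [e0]
      have i1 : |inner ℝ (W y) e * inner ℝ (V y) f| ≤ (‖W y‖ * ‖e‖) * (‖V y‖ * ‖f‖) := by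
        rw [abs_mul]
        gcongr <;> exact abs_real_inner_le_norm _ _
      have i2 : |inner ℝ (W y) f * inner ℝ (V y) e| ≤ (‖W y‖ * ‖f‖) * (‖V y‖ * ‖e‖) := by
        rw [abs_mul]
        gcongr <;> exact abs_real_inner_le_norm _ _
      have h4 := hVle y
      have hef : 0 ≤ ‖e‖ * ‖f‖ := by positivity
      have h9 : 2 * (‖W y‖ * ‖V y‖) ≤ 2 * ‖V y + (a * Real.tanh y) • W y‖ ^ 2 +
        (2 * a ^ 2 + 1) * ‖W y‖ ^ 2 := by nlinarith [sq_nonneg (‖W y‖ - ‖V y‖)]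
      calc _ ≤ _ := abs_sub _ _
        _ ≤ (2 * (‖W y‖ * ‖V y‖)) * (‖e‖ * ‖f‖) := by linarith
        _ ≤ _ := mul_le_mul_of_nonneg_right h9 hef
        _ = _ := by ring
    intro x f
    have := key (W x) f x
    rw [real_inner_self_eq_norm_sq, real_inner_comm (W x) (V x)] at this
    rw [real_inner_comm (V x) (W x)] at *
    linarith
end

section
variable {E : Type*} [NormedAddCommGroup E] [InnerProductSpace ℝ E]

lemma sc_zero (a : ℝ) (ha : 0 ≤ a) (W V : ℝ → E) (hW : ∀ x, HasDerivAt W (V x) x)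
    (hle : ∀ x, ‖V x‖ ≤ a * ‖W x‖) (x0 : ℝ) (h0 : W x0 = 0) (x : ℝ) : W x = 0 := by
  have hq : ∀ x, HasDerivAt (fun x => ‖W x‖ ^ 2) (2 * inner ℝ (W x) (V x)) x :=
    fun x => (hW x).norm_sq
  have hin : ∀ x, |inner ℝ (W x) (V x)| ≤ a * ‖W x‖ ^ 2 := by
    intro x
    have := abs_real_inner_le_norm (W x) (V x)
    nlinarith [hle x, norm_nonneg (W x)]
  have hexp : ∀ c x : ℝ, HasDerivAt (fun x => Real.exp (c * x)) (Real.exp (c * x) * c) x := by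
    intro c x
    simpa using ((hasDerivAt_id x).const_mul c).exp
  have hd : ∀ c x : ℝ, HasDerivAt (fun x => Real.exp (c * x) * ‖W x‖ ^ 2)
      (Real.exp (c * x) * c * ‖W x‖ ^ 2 + Real.exp (c * x) * (2 * inner ℝ (W x) (V x))) x :=
    fun c x => (hexp c x).mul (hq x)
  have fin : ∀ c : ℝ, Real.exp (c * x) * ‖W x‖ ^ 2 ≤ Real.exp (c * x0) * ‖W x0‖ ^ 2 → W x = 0 := by
    intro c h
    rw [h0] at h
    simp only [norm_zero, ne_eq, OfNat.ofNat_ne_zero, not_false_eq_true, zero_pow, mul_zero] at h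
    have h1 := Real.exp_pos (c * x)
    have h2 : ‖W x‖ ^ 2 ≤ 0 := by
      by_contra hh
      push Not at hh
      nlinarith [mul_pos h1 hh]
    have h3 : ‖W x‖ = 0 := by nlinarith [norm_nonneg (W x)]
    exact norm_eq_zero.1 h3
  rcases le_total x0 x with h | h
  · apply fin (-(2 * a))
    refine antitone_of_deriv_nonpos (f := fun x => Real.exp (-(2 * a) * x) * ‖W x‖ ^ 2)
      (fun x => (hd _ x).differentiableAt) (fun x => ?_) h
    rw [(hd _ x).deriv]
    have := (abs_le.1 (hin x)).2
    have h1 := Real.exp_pos (-(2 * a) * x)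
    nlinarith [mul_nonneg h1.le (sub_nonneg.2 this)]
  · apply fin (2 * a)
    refine monotone_of_deriv_nonneg (f := fun x => Real.exp ((2 * a) * x) * ‖W x‖ ^ 2)
      (fun x => (hd _ x).differentiableAt) (fun x => ?_) h
    rw [(hd _ x).deriv]
    have := (abs_le.1 (hin x)).1
    have h1 := Real.exp_pos ((2 * a) * x)
    nlinarith [mul_nonneg h1.le (sub_nonneg.2 this)]

lemma sc_core (b : ℝ) (hb : 0 < b) (W V : ℝ → E) (hW : ∀ x, HasDerivAt W (V x) x)
    (hV : ∀ x, HasDerivAt V ((1 / b) ^ 2 • W x - ((‖W x‖ ^ 2) ^ b) • W x) x)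
    (hint : Integrable (fun x => ‖V x + (1 / b * Real.tanh x) • W x‖ ^ 2)) :
    (∀ x, W x = 0) ∨ ∃ A B : ℝ, 0 < A ∧ A ^ 2 - B ^ 2 = b ^ 2 / (b + 1) ∧ ∃ Ω : E, ‖Ω‖ = 1 ∧
      ∀ x, 0 < A * Real.cosh x + B * Real.sinh x ∧
        W x = (A * Real.cosh x + B * Real.sinh x) ^ (-(1 / b)) • Ω := by
  obtain ⟨hE, hL⟩ := sc_conserved b hb W V hW hV hint
  by_cases hz : ∃ x0, W x0 = 0
  · left
    obtain ⟨x0, h0⟩ := hz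
    refine sc_zero (1 / b) (by positivity) W V hW ?_ x0 h0
    intro x
    have h1 := hE x
    have h2 : 0 ≤ (‖W x‖ ^ 2) ^ (b + 1) / (b + 1) := by positivity
    apply abs_le_of_sq_le_sq' _ (by positivity) |>.2
    rw [mul_pow]; linarith
  right
  push Not at hz
  have hq : ∀ x, HasDerivAt (fun x => ‖W x‖ ^ 2) (2 * inner ℝ (W x) (V x)) x :=
    fun x => (hW x).norm_sq
  set q : ℝ → ℝ := fun x => ‖W x‖ ^ 2 with hqdef
  set n : ℝ → ℝ := fun x => inner ℝ (W x) (V x) with hndef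
  have hqpos : ∀ x, 0 < q x := fun x => by
    have := norm_pos_iff.2 (hz x)
    simp only [hqdef]; positivity
  have hE' : ∀ x, ‖V x‖ ^ 2 = q x * ((1 / b) ^ 2 - q x ^ b / (b + 1)) := by
    intro x
    rw [hE x]
    simp only [hqdef]
    rw [Real.rpow_add_one (hqpos x).ne']
    ring
  have hn2 : ∀ x, n x ^ 2 = q x ^ 2 * ((1 / b) ^ 2 - q x ^ b / (b + 1)) := by
    intro x
    have := hL x (V x)
    rw [real_inner_self_eq_norm_sq, hE' x] at this
    simp only [hndef, hqdef] at *
    nlinarith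
  have hn : ∀ x, HasDerivAt n (‖V x‖ ^ 2 + (1 / b) ^ 2 * q x - q x ^ b * q x) x := by
    intro x
    have h := (hW x).inner ℝ (hV x)
    refine h.congr_deriv ?_
    rw [inner_sub_right, real_inner_smul_right, real_inner_smul_right,
      real_inner_self_eq_norm_sq, real_inner_self_eq_norm_sq]
    simp only [hqdef]; ring
  set u : ℝ → ℝ := fun x => q x ^ (-(b / 2)) with hudef
  set v : ℝ → ℝ := fun x => -b * (u x * (n x / q x)) with hvdef
  have hu : ∀ x, HasDerivAt u (v x) x := by
    intro x
    refine ((hq x).rpow_const (p := -(b / 2)) (Or.inl (hqpos x).ne')).congr_deriv ?_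
    simp only [hvdef, hudef]
    rw [Real.rpow_sub_one (hqpos x).ne']
    simp only [hndef]
    ring
  have hv : ∀ x, HasDerivAt v (u x) x := by
    intro x
    refine (((hu x).mul ((hn x).div (hq x) (hqpos x).ne')).const_mul (-b)).congr_deriv ?_
    have h1 := hn2 x
    have hq0 := (hqpos x).ne'
    have hi : inner ℝ (W x) (V x) = n x := rfl
    have hi2 : ‖W x‖ ^ 2 = q x := rfl
    simp only [hvdef, Pi.div_apply, hi, hi2]
    rw [hE' x]
    have h2 : (n x / q x) ^ 2 = (1 / b) ^ 2 - q x ^ b / (b + 1) := by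
      rw [div_pow, h1]; field_simp
    have h3 : ((q x * ((1 / b) ^ 2 - q x ^ b / (b + 1)) + (1 / b) ^ 2 * q x - q x ^ b * q x) * q x
        - n x * (2 * n x)) / q x ^ 2 = 
        ((1 / b) ^ 2 - q x ^ b / (b + 1)) + (1 / b) ^ 2 - q x ^ b - 2 * (n x / q x) ^ 2 := by
      field_simp
    rw [h3]
    have h4 : -b * (-b * (u x * (n x / q x)) * (n x / q x) + u x * (1 / b ^ 2 - q x ^ b / (b + 1) + 1 / b ^ 2 - q x ^ b - 2 * (n x / q x) ^ 2)) = u x * (-b * (-b * (n x / q x) ^ 2 + ((1 / b) ^ 2 - q x ^ b / (b + 1) + (1 / b) ^ 2 - q x ^ b - 2 * (n x / q x) ^ 2))) := by ring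
    rw [h2] at *
    have h5 : -b * (-b * ((1 / b) ^ 2 - q x ^ b / (b + 1)) + ((1 / b) ^ 2 - q x ^ b / (b + 1) + (1 / b) ^ 2 - q x ^ b - 2 * ((1 / b) ^ 2 - q x ^ b / (b + 1)))) = 1 := by
      field_simp
      ring
    have h6 : (1 / b) ^ 2 = 1 / b ^ 2 := by ring
    rw [h5] at h4
    simp only [h6] at *
    linarith
  have hu2 : ∀ x, u x ^ 2 - v x ^ 2 = b ^ 2 / (b + 1) := by
    intro x
    have h2 : (n x / q x) ^ 2 = (1 / b) ^ 2 - q x ^ b / (b + 1) := by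
      have hq0 := (hqpos x).ne'
      rw [div_pow, hn2 x]; field_simp
    have h3 : u x ^ 2 * q x ^ b = 1 := by
      simp only [hudef]
      rw [← Real.rpow_natCast, ← Real.rpow_mul (hqpos x).le, ← Real.rpow_add (hqpos x)]
      have : -(b / 2) * ((2:ℕ):ℝ) + b = 0 := by push_cast; ring
      rw [this, Real.rpow_zero]
    have h4 : v x ^ 2 = b ^ 2 * u x ^ 2 * (n x / q x) ^ 2 := by simp only [hvdef]; ring
    rw [h4, h2]
    have h5 : u x ^ 2 - b ^ 2 * u x ^ 2 * ((1 / b) ^ 2 - q x ^ b / (b + 1)) =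
      b ^ 2 / (b + 1) * (u x ^ 2 * q x ^ b) := by
      field_simp
      ring
    rw [h5, h3, mul_one]
  have hupos : ∀ x, 0 < u x := fun x => Real.rpow_pos_of_pos (hqpos x) _
  have hsol : ∀ x, u x = u 0 * Real.cosh x + v 0 * Real.sinh x := by
    intro x
    have hA := sc_eq_of_hasDerivAt_zero (fun x => ((hu x).mul (Real.hasDerivAt_cosh x)).sub
      ((hv x).mul (Real.hasDerivAt_sinh x))) (by intro x; ring) x 0
    have hB := sc_eq_of_hasDerivAt_zero (fun x => ((hv x).mul (Real.hasDerivAt_cosh x)).sub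
      ((hu x).mul (Real.hasDerivAt_sinh x))) (by intro x; ring) x 0
    simp at hA hB
    rw [← hA, ← hB]
    have := Real.cosh_sq x
    linear_combination (-u x) * this
  have hΩ : ∀ x, HasDerivAt (fun x => (q x ^ (-(1/2) : ℝ)) • W x) 0 x := by
    intro x
    have h := ((hq x).rpow_const (p := (-(1/2) : ℝ)) (Or.inl (hqpos x).ne')).smul (hW x)
    refine h.congr_deriv ?_
    rw [Real.rpow_sub_one (hqpos x).ne']
    have hVe : V x = (n x / q x) • W x := by
      refine ext_inner_right ℝ fun f => ?_
      have := hL x f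
      rw [real_inner_smul_left, div_mul_eq_mul_div, eq_div_iff (hqpos x).ne']
      simp only [hndef, hqdef]
      linarith
    have hi : inner ℝ (W x) (V x) = n x := rfl
    rw [hi]
    rw [hVe, smul_smul, ← add_smul]
    convert zero_smul ℝ (W x) using 2
    have hq0 := (hqpos x).ne'
    simp only [hqdef] at *
    field_simp
    ring
  refine ⟨u 0, v 0, hupos 0, hu2 0, (q 0 ^ (-(1/2) : ℝ)) • W 0, ?_, ?_⟩
  · rw [norm_smul, Real.norm_eq_abs, abs_of_pos (Real.rpow_pos_of_pos (hqpos 0) _)]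
    simp only [hqdef]
    rw [← Real.rpow_natCast, ← Real.rpow_mul (norm_nonneg _)]
    have hn0 := norm_pos_iff.2 (hz 0)
    norm_num
    rw [Real.rpow_neg_one, inv_mul_cancel₀ hn0.ne']
  · intro x
    refine ⟨by rw [← hsol]; exact hupos x, ?_⟩
    rw [← hsol]
    have e := sc_eq_of_hasDerivAt_zero hΩ (fun _ => rfl) 0 x
    rw [e]
    simp only [hudef]
    rw [← Real.rpow_mul (hqpos x).le, smul_smul, ← Real.rpow_add (hqpos x)]
    have : -(b / 2) * -(1 / b) + -(1 / 2) = 0 := by field_simp; ring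
    rw [this, Real.rpow_zero, one_smul]
end

lemma sc_ode (p : ℝ) (hp : 1 < p) {E : Type*} [NormedAddCommGroup E] [InnerProductSpace ℝ E]
    (w : ℝ → E) (y : ℝ) (hy : y ∈ Set.Ioo (-1 : ℝ) 1) (w2 : E)
    (h2 : HasDerivAt (deriv w) w2 y)
    (heq : (rho p y)⁻¹ • deriv (fun z => (rho p z * (1 - z ^ 2)) • deriv w z) y
        - (2 * (p + 1) / (p - 1) ^ 2) • w y + ‖w y‖ ^ (p - 1) • w y = 0) :
    (1 - y ^ 2) • w2 = (2 * (2 / (p - 1) + 1) * y) • deriv w y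
      + (2 / (p - 1) * (2 / (p - 1) + 1)) • w y - ‖w y‖ ^ (p - 1) • w y := by
  have hp1 : 0 < p - 1 := by linarith
  have hy2 : 0 < 1 - y ^ 2 := by nlinarith [hy.1, hy.2]
  have hr : 0 < rho p y := Real.rpow_pos_of_pos hy2 _
  have hs : HasDerivAt (fun z : ℝ => 1 - z ^ 2) (-(2 * y)) y := by
    simpa using ((hasDerivAt_pow 2 y).const_sub 1)
  have hρ : HasDerivAt (rho p) (-(2 * y) * (2 / (p - 1)) * (1 - y ^ 2) ^ (2 / (p - 1) - 1)) y :=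
    hs.rpow_const (Or.inl hy2.ne')
  have hd := ((hρ.mul hs).smul h2).deriv
  have hd' : deriv (fun z => (rho p z * (1 - z ^ 2)) • deriv w z) y =
      rho p y • ((1 - y ^ 2) • w2 - (2 * (2 / (p - 1) + 1) * y) • deriv w y) := by
    refine Eq.trans hd ?_
    rw [Real.rpow_sub_one hy2.ne']
    have : (1 - y ^ 2) ^ (2 / (p - 1)) = rho p y := rfl
    have h3 : -(2 * y) * (2 / (p - 1)) * (rho p y / (1 - y ^ 2)) * (1 - y ^ 2)
        + rho p y * -(2 * y) = -(rho p y * (2 * (2 / (p - 1) + 1) * y)) := by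
      field_simp
      ring
    rw [this, h3, Pi.mul_apply]
    module
  rw [hd', smul_smul, inv_mul_cancel₀ hr.ne', one_smul] at heq
  have hc : 2 * (p + 1) / (p - 1) ^ 2 = 2 / (p - 1) * (2 / (p - 1) + 1) := by
    field_simp; ring
  rw [hc] at heq
  rw [← sub_eq_zero, ← heq]
  abel

lemma sc_tanh_mem (x : ℝ) : Real.tanh x ∈ Set.Ioo (-1 : ℝ) 1 :=
  ⟨Real.neg_one_lt_tanh x, Real.tanh_lt_one x⟩

lemma sc_one_sub_tanh_sq (x : ℝ) : 1 - Real.tanh x ^ 2 = (Real.cosh x ^ 2)⁻¹ := by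
  rw [Real.tanh_eq_sinh_div_cosh]
  have := Real.cosh_sq x
  have := Real.cosh_pos x
  field_simp
  linarith

lemma sc_cosh_rpow (a x : ℝ) : HasDerivAt (fun x => Real.cosh x ^ (-a))
    (Real.cosh x ^ (-a) * (-(a * Real.tanh x))) x := by
  refine ((Real.hasDerivAt_cosh x).rpow_const (p := -a) (Or.inl (Real.cosh_pos x).ne')).congr_deriv ?_
  rw [Real.rpow_sub_one (Real.cosh_pos x).ne', Real.tanh_eq_sinh_div_cosh]
  ring

theorem stationary_classification (p : ℝ) (hp : 1 < p) (m : ℕ) (hm : 2 ≤ m)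
    (w : ℝ → EuclideanSpace ℝ (Fin m))
    (hw : ContDiffOn ℝ 2 w (Set.Ioo (-1 : ℝ) 1))
    (hint : MeasureTheory.IntegrableOn
      (fun y => (‖deriv w y‖ ^ 2 * (1 - y ^ 2) + ‖w y‖ ^ 2) * rho p y)
      (Set.Ioo (-1 : ℝ) 1))
    (heq : ∀ y ∈ Set.Ioo (-1 : ℝ) 1,
      (rho p y)⁻¹ • deriv (fun z => (rho p z * (1 - z ^ 2)) • deriv w z) y
        - (2 * (p + 1) / (p - 1) ^ 2) • w y + ‖w y‖ ^ (p - 1) • w y = 0) :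
    (∀ y ∈ Set.Ioo (-1 : ℝ) 1, w y = 0) ∨
    ∃ d ∈ Set.Ioo (-1 : ℝ) 1, ∃ Ω : EuclideanSpace ℝ (Fin m),
      ‖Ω‖ = 1 ∧ ∀ y ∈ Set.Ioo (-1 : ℝ) 1, w y = kappa p d y • Ω := by
  have hp1 : 0 < p - 1 := by linarith
  have hw1 : ∀ y ∈ Set.Ioo (-1 : ℝ) 1, HasDerivAt w (deriv w y) y := fun y hy =>
    ((hw.differentiableOn (by norm_num)).differentiableAt (isOpen_Ioo.mem_nhds hy)).hasDerivAt
  have hwd : ContDiffOn ℝ 1 (deriv w) (Set.Ioo (-1 : ℝ) 1) :=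
    hw.deriv_of_isOpen isOpen_Ioo (by norm_num)
  have hw2 : ∀ y ∈ Set.Ioo (-1 : ℝ) 1, HasDerivAt (deriv w) (deriv (deriv w) y) y := fun y hy =>
    ((hwd.differentiableOn (by norm_num)).differentiableAt (isOpen_Ioo.mem_nhds hy)).hasDerivAt
  have hode := fun y hy => sc_ode p hp w y hy _ (hw2 y hy) (heq y hy)
  set b := (p - 1) / 2 with hb
  have hb0 : 0 < b := by positivity
  have hab : 2 / (p - 1) = 1 / b := by rw [hb]; field_simp
  rw [hab] at hode
  set a := 1 / b with ha
  have ha0 : 0 < a := by positivity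
  set W : ℝ → EuclideanSpace ℝ (Fin m) := fun x => Real.cosh x ^ (-a) • w (Real.tanh x) with hWdef
  set V : ℝ → EuclideanSpace ℝ (Fin m) := fun x => Real.cosh x ^ (-a) •
    ((Real.cosh x ^ 2)⁻¹ • deriv w (Real.tanh x) - (a * Real.tanh x) • w (Real.tanh x)) with hVdef
  have hwt : ∀ x, HasDerivAt (fun x => w (Real.tanh x))
      ((Real.cosh x ^ 2)⁻¹ • deriv w (Real.tanh x)) x := fun x =>
    (hw1 _ (sc_tanh_mem x)).scomp x (sc_hasDerivAt_tanh x)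
  have hwt2 : ∀ x, HasDerivAt (fun x => deriv w (Real.tanh x))
      ((Real.cosh x ^ 2)⁻¹ • deriv (deriv w) (Real.tanh x)) x := fun x =>
    (hw2 _ (sc_tanh_mem x)).scomp x (sc_hasDerivAt_tanh x)
  have hW : ∀ x, HasDerivAt W (V x) x := by
    intro x
    refine ((sc_cosh_rpow a x).smul (hwt x)).congr_deriv ?_
    simp only [hVdef]
    module
  have hnorm : ∀ x, (‖W x‖ ^ 2) ^ b = (Real.cosh x ^ 2)⁻¹ * ‖w (Real.tanh x)‖ ^ (p - 1) := by
    intro x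
    have hc := Real.cosh_pos x
    have hcr : 0 < Real.cosh x ^ (-a) := Real.rpow_pos_of_pos hc _
    simp only [hWdef]
    rw [norm_smul, Real.norm_eq_abs, abs_of_pos hcr, mul_pow, Real.mul_rpow (by positivity) (by positivity)]
    rw [← Real.rpow_natCast, ← Real.rpow_natCast, ← Real.rpow_mul hcr.le, ← Real.rpow_mul hc.le,
      ← Real.rpow_mul (norm_nonneg _)]
    have e1 : -a * (((2:ℕ):ℝ) * b) = -((2:ℕ):ℝ) := by rw [ha]; push_cast; field_simp
    have e2 : ((2:ℕ):ℝ) * b = p - 1 := by rw [hb]; push_cast; ring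
    rw [e1, e2, Real.rpow_neg hc.le, Real.rpow_natCast]
  have hV : ∀ x, HasDerivAt V (a ^ 2 • W x - ((‖W x‖ ^ 2) ^ b) • W x) x := by
    intro x
    have hsech : HasDerivAt (fun x => (Real.cosh x ^ 2)⁻¹)
        (-(2 * Real.tanh x) * (Real.cosh x ^ 2)⁻¹) x := by
      have h := (((sc_hasDerivAt_tanh x).pow 2).const_sub 1)
      have e : (fun x => (Real.cosh x ^ 2)⁻¹) = fun x => 1 - (Real.tanh ^ 2) x := by
        funext z; rw [← sc_one_sub_tanh_sq]; rfl
      rw [e]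
      refine h.congr_deriv ?_
      push_cast
      ring
    have h := (sc_cosh_rpow a x).smul ((hsech.smul (hwt2 x)).sub
      (((sc_hasDerivAt_tanh x).const_mul a).smul (hwt x)))
    refine h.congr_deriv ?_
    rw [hnorm x]
    have ho := hode _ (sc_tanh_mem x)
    rw [sc_one_sub_tanh_sq] at ho
    rw [ho]
    simp only [hWdef]
    have ht := sc_one_sub_tanh_sq x
    have ht' : (Real.cosh x ^ 2)⁻¹ = 1 - Real.tanh x ^ 2 := ht.symm
    simp only [Pi.smul_apply', Pi.sub_apply, ht']
    module
  have hintW : Integrable (fun x => ‖V x + (a * Real.tanh x) • W x‖ ^ 2) := by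
    have him : Real.tanh '' Set.univ = Set.Ioo (-1 : ℝ) 1 := Real.tanh_bijOn.image_eq
    rw [← him, integrableOn_image_iff_integrableOn_abs_deriv_smul MeasurableSet.univ
      (fun x _ => (sc_hasDerivAt_tanh x).hasDerivWithinAt) Real.tanh_injective.injOn,
      integrableOn_univ] at hint
    refine Integrable.mono' hint ?_ ?_
    · have c1 : Continuous V := continuous_iff_continuousAt.2 fun x => (hV x).continuousAt
      have c2 : Continuous W := continuous_iff_continuousAt.2 fun x => (hW x).continuousAt
      have c3 := sc_continuous_tanh
      exact Continuous.aestronglyMeasurable (by fun_prop)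
    · refine Filter.Eventually.of_forall fun x => ?_
      have hc := Real.cosh_pos x
      have hcr : 0 < Real.cosh x ^ (-a) := Real.rpow_pos_of_pos hc _
      have e : V x + (a * Real.tanh x) • W x =
          (Real.cosh x ^ (-a) * (Real.cosh x ^ 2)⁻¹) • deriv w (Real.tanh x) := by
        simp only [hVdef, hWdef]; module
      have hrho : rho p (Real.tanh x) = (Real.cosh x ^ (-a)) ^ 2 := by
        unfold rho
        rw [sc_one_sub_tanh_sq, hab, Real.inv_rpow (by positivity), ← Real.rpow_natCast,
          ← Real.rpow_natCast, ← Real.rpow_mul hc.le, ← Real.rpow_mul hc.le, ← Real.rpow_neg hc.le]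
        congr 1; ring
      rw [e, hrho, sc_one_sub_tanh_sq, norm_smul, norm_pow, norm_mul, norm_norm, Real.norm_eq_abs,
        abs_of_pos (by positivity), abs_of_pos (by positivity), smul_eq_mul]
      have hpos : 0 ≤ (Real.cosh x ^ 2)⁻¹ * (‖w (Real.tanh x)‖ ^ 2 * (Real.cosh x ^ (-a)) ^ 2) := by
        positivity
      rw [norm_norm]
      set D := ‖deriv w (Real.tanh x)‖
      set k := Real.cosh x ^ (-a)
      set l := (Real.cosh x ^ 2)⁻¹
      have : l * ((D ^ 2 * l + ‖w (Real.tanh x)‖ ^ 2) * k ^ 2) =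
        (k * l * D) ^ 2 + l * (‖w (Real.tanh x)‖ ^ 2 * k ^ 2) := by ring
      linarith
  rcases sc_core b hb0 W V hW hV hintW with h | ⟨A, B, hA, hAB, Ω, hΩ, h⟩
  · left
    intro y hy
    have h1 := h (Real.artanh y)
    simp only [hWdef, Real.tanh_artanh hy] at h1
    exact (smul_eq_zero.1 h1).resolve_left (Real.rpow_pos_of_pos (Real.cosh_pos _) _).ne'
  · right
    have hB2 : B ^ 2 < A ^ 2 := by
      have : 0 < b ^ 2 / (b + 1) := by positivity
      linarith
    have hBA := abs_lt_of_sq_lt_sq' hB2 hA.le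
    have hd : B / A ∈ Set.Ioo (-1 : ℝ) 1 := by
      constructor
      · rw [lt_div_iff₀ hA]; linarith
      · rw [div_lt_iff₀ hA]; linarith
    have hd2 : 0 < 1 - (B / A) ^ 2 := by nlinarith [hd.1, hd.2]
    refine ⟨B / A, hd, Ω, hΩ, ?_⟩
    intro y hy
    obtain ⟨h0, h1⟩ := h (Real.artanh y)
    set x := Real.artanh y with hx
    have hc := Real.cosh_pos x
    have hcr : 0 < Real.cosh x ^ (-a) := Real.rpow_pos_of_pos hc _
    have hty : Real.tanh x = y := Real.tanh_artanh hy
    have hfac : A * Real.cosh x + B * Real.sinh x = Real.cosh x * (A * (1 + B / A * y)) := by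
      rw [← hty, Real.tanh_eq_sinh_div_cosh]; field_simp
    have hdy : 0 < 1 + B / A * y := by
      rw [hfac] at h0
      exact (mul_pos_iff_of_pos_left hA).1 ((mul_pos_iff_of_pos_left hc).1 h0)
    rw [hfac, Real.mul_rpow hc.le (by positivity), Real.mul_rpow hA.le hdy.le, ← smul_smul] at h1
    simp only [hWdef, hty] at h1
    have h2 := smul_right_injective _ hcr.ne' h1
    rw [h2]
    congr 1
    unfold kappa kappa0
    rw [hab, ← Real.mul_rpow (by positivity) hd2.le]
    congr 1
    have e : 2 * (p + 1) / (p - 1) ^ 2 * (1 - (B / A) ^ 2) = (A ^ 2)⁻¹ := by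
      have e1 : 1 - (B / A) ^ 2 = (b ^ 2 / (b + 1)) / A ^ 2 := by
        rw [← hAB]; field_simp
      have hpp : p + 1 ≠ 0 := by linarith
      have hbp : b + 1 = (p + 1) / 2 := by rw [hb]; ring
      rw [e1, hbp, hb]; field_simp
    have e2 : 1 / (p - 1) = a / 2 := by rw [ha, hb]; field_simp
    rw [e, e2, Real.inv_rpow (by positivity), ← Real.rpow_natCast, ← Real.rpow_mul hA.le,
      ← Real.rpow_neg hA.le]
    congr 1
    push_cast; ring
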